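/- For every integer D ≥ 2, there exists ε > 0 such that for all complex numbers g_1, …, g_D with |g_i| < ε for each i, the sum F(g_1,…,g_D) = ∑_{(p_1,…,p_D) ∈ ℕ^D} C^1_{p_1…p_D} ∏_i g_i^{p_i} satisfies the algebraic equation F = ∑_{k=0}^{D} (∑_{1 ≤ i_1 < ⋯ < i_k ≤ D} g_{i_1} ⋯ g_{i_k}) F^k, where the k = 0 summand is 1. -/

import Mathlib

/-- The complex number `C¹_{p₁…p_D} = (1/(p₁+⋯+p_D+1)) · ∏_j binom(p₁+⋯+p_D+1, p_j)`. -/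
noncomputable def C1 (D : ℕ) (p : Fin D → ℕ) : ℂ :=
  (1 : ℂ) / ((∑ i, p i : ℕ) + 1) * ∏ j, ((∑ i, p i + 1).choose (p j) : ℂ)

/-- The generating function `F(g₁,…,g_D) = ∑_{(p₁,…,p_D) ∈ ℕ^D} C¹_{p₁…p_D} ∏_i g_iᵖⁱ`. -/
noncomputable def F (D : ℕ) (g : Fin D → ℂ) : ℂ :=
  ∑' p : Fin D → ℕ, C1 D p * ∏ i, g i ^ p i

open PowerSeries in
/-- Lagrange-type coefficients. -/
noncomputable def lagB (Φ : PowerSeries ℂ) (r n : ℕ) : ℂ :=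
  if n + r = 0 then 1 else (r : ℂ) / ((n : ℂ) + r) * coeff n (Φ ^ (n + r))

open PowerSeries in
lemma lagB_zero (Φ : PowerSeries ℂ) (n : ℕ) : lagB Φ 0 n = if n = 0 then 1 else 0 := by
  simp [lagB]

open PowerSeries in
lemma coeff_X_mul_derivative (f : PowerSeries ℂ) (n : ℕ) :
    coeff n (X * derivative ℂ f) = n * coeff n f := by
  cases n with
  | zero => simp
  | succ n => rw [coeff_succ_X_mul, coeff_derivative]; push_cast; ring

open PowerSeries in
lemma lagB_rec (Φ : PowerSeries ℂ) (h0 : coeff 0 Φ = 1) (r n : ℕ) :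
    lagB Φ (r + 1) n =
      ∑ kl ∈ Finset.HasAntidiagonal.antidiagonal n, coeff kl.1 Φ * lagB Φ (r + kl.1) kl.2 := by
  by_cases hnr : n + r = 0
  · obtain ⟨rfl, rfl⟩ : n = 0 ∧ r = 0 := by omega
    have h0' : constantCoeff Φ = 1 := by simpa using h0
    simp [lagB, h0']
  have hne : (n : ℂ) + r ≠ 0 := by exact_mod_cast hnr
  have hne1 : (n : ℂ) + r + 1 ≠ 0 := by exact_mod_cast (Nat.succ_ne_zero (n + r))
  have h1 : ∀ kl ∈ Finset.HasAntidiagonal.antidiagonal n, coeff kl.1 Φ * lagB Φ (r + kl.1) kl.2 =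
      (1 / ((n : ℂ) + r)) * (coeff kl.1 (r • Φ + X * derivative ℂ Φ) * coeff kl.2 (Φ ^ (n + r))) := by
    rintro ⟨k, m⟩ hk
    rw [Finset.HasAntidiagonal.mem_antidiagonal] at hk
    simp only at hk ⊢
    subst hk
    have e : m + (r + k) = k + m + r := by ring
    rw [map_add, coeff_X_mul_derivative, lagB, if_neg (by omega), e]
    have e2 : (m : ℂ) + ((r + k : ℕ) : ℂ) = ((k + m : ℕ) : ℂ) + r := by push_cast; ring
    rw [e2, map_nsmul]
    push_cast
    simp only [nsmul_eq_mul]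
    ring
  rw [Finset.sum_congr rfl h1, ← Finset.mul_sum, ← coeff_mul]
  have h2 : ((n + r + 1 : ℕ) : PowerSeries ℂ) * ((r • Φ + X * derivative ℂ Φ) * Φ ^ (n + r)) =
      (((n + r + 1) * r : ℕ) : PowerSeries ℂ) * Φ ^ (n + r + 1)
        + X * derivative ℂ (Φ ^ (n + r + 1)) := by
    rw [Derivation.leibniz_pow]
    simp only [nsmul_eq_mul, smul_eq_mul, Nat.add_sub_cancel]
    push_cast
    ring
  have h3 := congrArg (coeff n) h2
  rw [map_add, coeff_X_mul_derivative, ← nsmul_eq_mul, ← nsmul_eq_mul, map_nsmul, map_nsmul] at h3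
  simp only [nsmul_eq_mul] at h3
  push_cast at h3
  rw [lagB, if_neg (by omega)]
  have e : n + (r + 1) = n + r + 1 := by ring
  rw [e]
  push_cast
  have h4 : coeff n ((r • Φ + X * derivative ℂ Φ) * Φ ^ (n + r)) =
      (((n : ℂ) + r + 1) * r + n) * coeff n (Φ ^ (n + r + 1)) / ((n : ℂ) + r + 1) := by
    rw [eq_div_iff hne1]
    simp only [nsmul_eq_mul]
    linear_combination h3
  rw [h4, ← add_assoc]
  field_simp
  ring

lemma rec_unique (φ : ℕ → ℂ) (h0 : φ 0 = 1) (x y : ℕ → ℕ → ℂ)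
    (hx : ∀ r n, x (r + 1) n = ∑ kl ∈ Finset.HasAntidiagonal.antidiagonal n, φ kl.1 * x (r + kl.1) kl.2)
    (hy : ∀ r n, y (r + 1) n = ∑ kl ∈ Finset.HasAntidiagonal.antidiagonal n, φ kl.1 * y (r + kl.1) kl.2)
    (hz : ∀ n, x 0 n = y 0 n) (n : ℕ) : ∀ r, x r n = y r n := by
  induction n using Nat.strong_induction_on with
  | _ n ih =>
    intro r
    induction r with
    | zero => exact hz n
    | succ r ihr =>
      rw [hx, hy]
      refine Finset.sum_congr rfl ?_
      rintro ⟨k, m⟩ hk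
      rw [Finset.HasAntidiagonal.mem_antidiagonal] at hk
      simp only at hk ⊢
      rcases Nat.eq_zero_or_pos k with rfl | hk0
      · obtain rfl : m = n := by omega
        rw [Nat.add_zero, ihr]
      · rw [ih m (by omega)]

open PowerSeries in
lemma lagB_mul (Φ : PowerSeries ℂ) (h0 : coeff 0 Φ = 1) (r s : ℕ) :
    mk (lagB Φ r) * mk (lagB Φ s) = mk (lagB Φ (r + s)) := by
  ext n
  rw [coeff_mk]
  refine rec_unique (fun k => coeff k Φ) h0
    (fun r n => coeff n (mk (lagB Φ r) * mk (lagB Φ s))) (fun r n => lagB Φ (r + s) n)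
    ?_ ?_ ?_ n r
  · intro r n
    simp only [coeff_mul, coeff_mk]
    simp_rw [lagB_rec Φ h0, Finset.sum_mul, Finset.mul_sum]
    rw [Finset.sum_sigma', Finset.sum_sigma']
    refine Finset.sum_nbij' (fun x => ⟨(x.2.1, x.2.2 + x.1.2), (x.2.2, x.1.2)⟩)
      (fun x => ⟨(x.1.1 + x.2.1, x.2.2), (x.1.1, x.2.1)⟩) ?_ ?_ ?_ ?_ ?_
    all_goals
      rintro ⟨⟨a, b⟩, ⟨c, d⟩⟩ h
      simp only [Finset.mem_sigma, Finset.HasAntidiagonal.mem_antidiagonal] at h ⊢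
    · grind
    · grind
    · obtain ⟨_, rfl⟩ := h; rfl
    · obtain ⟨_, rfl⟩ := h; rfl
    · ring
  · intro r n
    have := lagB_rec Φ h0 (r + s) n
    rw [show r + 1 + s = r + s + 1 by ring, this]
    refine Finset.sum_congr rfl fun kl _ => ?_
    rw [show r + s + kl.1 = r + kl.1 + s by ring]
  · intro n
    have : mk (lagB Φ 0) = 1 := by
      ext n; rw [coeff_mk, lagB_zero, coeff_one]
    simp [this]

open PowerSeries in
lemma lagB_pow (Φ : PowerSeries ℂ) (h0 : coeff 0 Φ = 1) (r : ℕ) :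
    mk (lagB Φ 1) ^ r = mk (lagB Φ r) := by
  induction r with
  | zero => ext n; rw [coeff_mk, lagB_zero, pow_zero, coeff_one]
  | succ r ih => rw [pow_succ, ih, lagB_mul Φ h0]

open PowerSeries in
lemma lagB_eq (Φ : PowerSeries ℂ) (h0 : coeff 0 Φ = 1) (D : ℕ) (hD : ∀ k, D < k → coeff k Φ = 0) :
    mk (lagB Φ 1) = ∑ k ∈ Finset.range (D + 1), (C (coeff k Φ) * X ^ k) * mk (lagB Φ 1) ^ k := by
  ext n
  have hrec := lagB_rec Φ h0 0 n
  rw [zero_add] at hrec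
  rw [coeff_mk, map_sum, hrec,
    Finset.Nat.sum_antidiagonal_eq_sum_range_succ_mk]
  have h1 : ∀ k, coeff n ((C (coeff k Φ) * X ^ k) * mk (lagB Φ 1) ^ k) =
      if k ≤ n then coeff k Φ * lagB Φ k (n - k) else 0 := by
    intro k
    rw [mul_assoc, coeff_C_mul, coeff_X_pow_mul', lagB_pow Φ h0]
    split_ifs <;> simp
  simp_rw [h1]
  have h2 : ∀ k ∈ Finset.range n.succ, coeff k Φ * lagB Φ (0 + k) (n - k) =
    if k ≤ n then coeff k Φ * lagB Φ k (n - k) else 0 := by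
    intro k hk
    rw [if_pos (by simpa [Nat.lt_succ_iff] using hk), zero_add]
  rw [Finset.sum_congr rfl h2]
  trans ∑ k ∈ Finset.range (n + D + 1), if k ≤ n then coeff k Φ * lagB Φ k (n - k) else 0
  · refine Finset.sum_subset (Finset.range_mono (by omega)) ?_
    intro k _ hk
    rw [if_neg (by simpa using hk)]
  · symm
    refine Finset.sum_subset (Finset.range_mono (by omega)) ?_
    intro k _ hk
    rw [hD k (by simpa using hk)]
    simp

open PowerSeries in
lemma eval_mul (f g : PowerSeries ℂ) (hf : Summable fun n => ‖coeff n f‖)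
    (hg : Summable fun n => ‖coeff n g‖) :
    (Summable fun n => ‖coeff n (f * g)‖) ∧
      ∑' n, coeff n (f * g) = (∑' n, coeff n f) * ∑' n, coeff n g := by
  have key : ∀ n, coeff n (f * g) = ∑ kl ∈ Finset.HasAntidiagonal.antidiagonal n,
      (fun n => coeff n f) kl.1 * (fun n => coeff n g) kl.2 := fun n => coeff_mul n f g
  have e : (fun n => coeff n (f * g)) = fun n => ∑ kl ∈ Finset.HasAntidiagonal.antidiagonal n,
      (fun n => coeff n f) kl.1 * (fun n => coeff n g) kl.2 := funext key
  have e2 : (fun n => ‖coeff n (f * g)‖) = fun n =>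
      ‖∑ kl ∈ Finset.HasAntidiagonal.antidiagonal n,
      (fun n => coeff n f) kl.1 * (fun n => coeff n g) kl.2‖ := funext fun n => by rw [key n]
  rw [e, e2]
  exact ⟨summable_norm_sum_mul_antidiagonal_of_summable_norm (f := fun n => coeff n f)
      (g := fun n => coeff n g) hf hg,
    (tsum_mul_tsum_eq_tsum_sum_antidiagonal_of_summable_norm (f := fun n => coeff n f)
      (g := fun n => coeff n g) hf hg).symm⟩

open PowerSeries in
lemma eval_pow (f : PowerSeries ℂ) (hf : Summable fun n => ‖coeff n f‖) (k : ℕ) :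
    (Summable fun n => ‖coeff n (f ^ k)‖) ∧ ∑' n, coeff n (f ^ k) = (∑' n, coeff n f) ^ k := by
  induction k with
  | zero =>
    constructor
    · refine summable_of_ne_finset_zero (s := {0}) fun n hn => ?_
      simp at hn
      simp [coeff_one, hn]
    · simp [coeff_one]
  | succ k ih =>
    obtain ⟨h1, h2⟩ := ih
    rw [pow_succ, pow_succ, ← h2]
    exact eval_mul _ _ h1 hf

open PowerSeries in
lemma eval_mono (f : PowerSeries ℂ) (hf : Summable fun n => ‖coeff n f‖) (a : ℂ) (k : ℕ) :
    (Summable fun n => coeff n ((C a * X ^ k) * f)) ∧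
      ∑' n, coeff n ((C a * X ^ k) * f) = a * ∑' n, coeff n f := by
  have h1 : Summable fun n => ‖coeff n (C a * X ^ k : PowerSeries ℂ)‖ := by
    refine summable_of_ne_finset_zero (s := {k}) fun n hn => ?_
    simp at hn
    simp [coeff_C_mul, coeff_X_pow, hn]
  have h2 : ∑' n, coeff n (C a * X ^ k : PowerSeries ℂ) = a := by
    simp [coeff_C_mul_X_pow]
  have h3 := eval_mul _ _ h1 hf
  rw [h2] at h3
  exact ⟨h3.1.of_norm, h3.2⟩

open PowerSeries in
lemma eval_eq (Φ : PowerSeries ℂ) (h0 : coeff 0 Φ = 1) (D : ℕ) (hD : ∀ k, D < k → coeff k Φ = 0)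
    (hs : Summable fun n => ‖lagB Φ 1 n‖) :
    ∑' n, lagB Φ 1 n = ∑ k ∈ Finset.range (D + 1), coeff k Φ * (∑' n, lagB Φ 1 n) ^ k := by
  have hs' : Summable fun n => ‖coeff n (mk (lagB Φ 1))‖ := by simpa using hs
  have h1 : ∑' n, lagB Φ 1 n = ∑' n, coeff n (mk (lagB Φ 1)) := by simp
  rw [h1]
  conv_lhs => rw [lagB_eq Φ h0 D hD]
  simp_rw [map_sum]
  rw [Summable.tsum_finsetSum fun k _ => (eval_mono _ (eval_pow _ hs' k).1 _ k).1]
  refine Finset.sum_congr rfl fun k _ => ?_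
  rw [(eval_mono _ (eval_pow _ hs' k).1 _ k).2, (eval_pow _ hs' k).2]

open PowerSeries in
lemma coeff_one_add_CX_pow (a : ℂ) (N k : ℕ) :
    coeff k ((1 + C a * X : PowerSeries ℂ) ^ N) = N.choose k * a ^ k := by
  have : (1 + C a * X : PowerSeries ℂ) ^ N =
      ((((1 + Polynomial.X : Polynomial ℂ) ^ N).comp
        (Polynomial.C a * Polynomial.X) : Polynomial ℂ) : PowerSeries ℂ) := by
    simp
  rw [this, Polynomial.coeff_coe, Polynomial.comp_C_mul_X_coeff, Polynomial.coeff_one_add_X_pow]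

open PowerSeries in
lemma coeff_Phi (D : ℕ) (g : Fin D → ℂ) (k : ℕ) :
    coeff k (∏ i, (1 + C (g i) * X) : PowerSeries ℂ) =
      ∑ S ∈ Finset.powersetCard k (Finset.univ : Finset (Fin D)), ∏ i ∈ S, g i := by
  rw [Finset.prod_one_add, map_sum]
  have h : ∀ S : Finset (Fin D), coeff k (∏ i ∈ S, (C (g i) * X) : PowerSeries ℂ) =
      if S.card = k then ∏ i ∈ S, g i else 0 := by
    intro S
    rw [Finset.prod_mul_distrib, Finset.prod_const, ← map_prod, coeff_C_mul_X_pow]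
    simp only [eq_comm]
  simp_rw [h]
  rw [← Finset.sum_filter]
  refine Finset.sum_congr ?_ fun _ _ => rfl
  ext S
  simp [Finset.mem_powersetCard]

open PowerSeries in
lemma lagB_one_eq (D : ℕ) (g : Fin D → ℂ) (n : ℕ) :
    lagB (∏ i, (1 + C (g i) * X) : PowerSeries ℂ) 1 n =
      ∑ p ∈ Finset.piAntidiag Finset.univ n, C1 D p * ∏ i, g i ^ p i := by
  rw [lagB, if_neg (by omega), ← Finset.prod_pow, coeff_prod, Finset.mul_sum]
  simp_rw [coeff_one_add_CX_pow]
  refine Finset.sum_nbij' (fun p => ⇑p) (fun p => Finsupp.equivFunOnFinite.symm p) ?_ ?_ ?_ ?_ ?_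
  · intro p hp
    simpa using hp
  · intro p hp
    simpa using hp
  · intro p hp
    ext; simp
  · intro p hp
    ext; simp
  · intro p hp
    have hp : ∑ i, p i = n := by simpa using hp
    rw [C1, hp, Finset.prod_mul_distrib]
    push_cast
    ring

lemma summable_terms (D : ℕ) (g : Fin D → ℂ) (hg : ∀ i, ‖g i‖ < (1 / 2) ^ (D + 1)) :
    Summable fun p : Fin D → ℕ => ‖C1 D p * ∏ i, g i ^ p i‖ := by
  have hgeo : Summable fun p : Fin D → ℕ => ∏ i, (1 / 2 : ℝ) ^ p i := by
    refine summable_of_sum_le (c := 2 ^ D) (fun p => by positivity) ?_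
    intro u
    obtain ⟨N, hN⟩ : ∃ N, ∀ p ∈ u, ∀ i, p i < N := by
      refine ⟨u.sup (fun p => ∑ i, p i) + 1, fun p hp i => ?_⟩
      have h1 := Finset.le_sup (f := fun p : Fin D → ℕ => ∑ i, p i) hp
      have h2 := Finset.single_le_sum (f := p) (fun _ _ => Nat.zero_le _) (Finset.mem_univ i)
      exact Nat.lt_succ_of_le (h2.trans h1)
    calc ∑ p ∈ u, ∏ i, (1 / 2 : ℝ) ^ p i
        ≤ ∑ p ∈ Fintype.piFinset (fun _ : Fin D => Finset.range N), ∏ i, (1 / 2 : ℝ) ^ p i := by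
          refine Finset.sum_le_sum_of_subset_of_nonneg ?_ fun _ _ _ => by positivity
          intro p hp
          simpa using hN p hp
      _ = ∏ i : Fin D, ∑ j ∈ Finset.range N, (1 / 2 : ℝ) ^ j := by
          rw [Finset.prod_univ_sum]
      _ ≤ 2 ^ D := by
          rw [Finset.prod_const, Finset.card_univ, Fintype.card_fin]
          refine pow_le_pow_left₀ (Finset.sum_nonneg fun _ _ => by positivity) ?_ _
          refine le_of_le_of_eq ?_ tsum_geometric_two
          exact summable_geometric_two.sum_le_tsum _ fun _ _ => by positivity
  refine Summable.of_nonneg_of_le (fun _ => norm_nonneg _) ?_ (hgeo.mul_left (2 ^ D))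
  intro p
  have h1 : ‖C1 D p‖ ≤ ∏ j : Fin D, (2 : ℝ) ^ (∑ i, p i + 1) := by
    rw [C1, norm_mul, norm_prod]
    have ha : ‖(1 : ℂ) / ((∑ i, p i : ℕ) + 1)‖ ≤ 1 := by
      rw [← Nat.cast_add_one, norm_div, norm_one, Complex.norm_natCast]
      refine div_le_one_of_le₀ ?_ (by positivity)
      push_cast
      have : (0 : ℝ) ≤ ∑ i, (p i : ℝ) := by positivity
      linarith
    have hb : ∏ j, ‖((∑ i, p i + 1).choose (p j) : ℂ)‖ ≤ ∏ j : Fin D, (2 : ℝ) ^ (∑ i, p i + 1) := by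
      refine Finset.prod_le_prod (fun _ _ => norm_nonneg _) fun j _ => ?_
      rw [Complex.norm_natCast]
      exact_mod_cast Nat.choose_le_two_pow _ _
    calc _ ≤ 1 * ∏ j : Fin D, (2 : ℝ) ^ (∑ i, p i + 1) :=
          mul_le_mul ha hb (by positivity) zero_le_one
      _ = _ := one_mul _
  have h2 : ‖∏ i, g i ^ p i‖ ≤ ∏ i, ((1 / 2 : ℝ) ^ (D + 1)) ^ p i := by
    rw [norm_prod]
    refine Finset.prod_le_prod (fun _ _ => norm_nonneg _) fun j _ => ?_
    rw [norm_pow]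
    exact pow_le_pow_left₀ (norm_nonneg _) (hg j).le _
  rw [norm_mul]
  refine (mul_le_mul h1 h2 (norm_nonneg _) (by positivity)).trans (le_of_eq ?_)
  rw [Finset.prod_const, Finset.prod_pow_eq_pow_sum, Finset.prod_pow_eq_pow_sum, Finset.card_univ,
    Fintype.card_fin, ← pow_mul, ← pow_mul]
  generalize ∑ i, p i = s
  rw [show (s + 1) * D = D + D * s by ring, show (D + 1) * s = D * s + s by ring, pow_add, pow_add]
  have : (2 : ℝ) ^ (D * s) * (1 / 2) ^ (D * s) = 1 := by
    rw [← mul_pow]; norm_num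
  linear_combination (2 : ℝ) ^ D * (1 / 2) ^ s * this

lemma fiber_tsum {E : Type*} [NormedAddCommGroup E] (D n : ℕ) (f : (Fin D → ℕ) → E) :
    ∑' b : ((fun p : Fin D → ℕ => ∑ i, p i) ⁻¹' {n}), f b =
      ∑ p ∈ Finset.piAntidiag Finset.univ n, f p := by
  have : ((fun p : Fin D → ℕ => ∑ i, p i) ⁻¹' {n}) =
      ((Finset.piAntidiag Finset.univ n : Finset (Fin D → ℕ)) : Set (Fin D → ℕ)) := by
    ext p; simp
  rw [this, Finset.tsum_subtype' (Finset.piAntidiag Finset.univ n) f]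

theorem F_algebraic_equation (D : ℕ) (hD : 2 ≤ D) :
    ∃ ε > 0, ∀ g : Fin D → ℂ, (∀ i, ‖g i‖ < ε) →
      F D g = ∑ k ∈ Finset.range (D + 1),
        (∑ S ∈ Finset.powersetCard k (Finset.univ : Finset (Fin D)), ∏ i ∈ S, g i) *
          F D g ^ k := by
  refine ⟨(1 / 2) ^ (D + 1), by positivity, fun g hg => ?_⟩
  have hs := summable_terms D g hg
  have h1 := hs.of_norm.hasSum.tsum_fiberwise (fun p : Fin D → ℕ => ∑ i, p i)
  have h2 := hs.hasSum.tsum_fiberwise (fun p : Fin D → ℕ => ∑ i, p i)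
  simp_rw [fiber_tsum D _ (fun p => C1 D p * ∏ i, g i ^ p i), ← lagB_one_eq] at h1
  simp_rw [fiber_tsum D _ (fun p => ‖C1 D p * ∏ i, g i ^ p i‖)] at h2
  have h3 : F D g = ∑' n, lagB (∏ i, (1 + PowerSeries.C (g i) * PowerSeries.X)) 1 n :=
    h1.tsum_eq.symm
  rw [h3]
  simp_rw [← coeff_Phi]
  refine eval_eq _ ?_ D ?_ ?_
  · simp [coeff_Phi]
  · intro k hk
    rw [coeff_Phi, Finset.powersetCard_eq_empty.2 (by simpa using hk), Finset.sum_empty]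
  · refine Summable.of_nonneg_of_le (fun _ => norm_nonneg _) (fun n => ?_) h2.summable
    rw [lagB_one_eq]
    exact norm_sum_le _ _
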